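/- Uniqueness up to positive scalar of the last defining differential on the tangent cone: let 1 ≤ k ≤ n−1, let O ⊆ ℍ^n be open, let S ⊆ ℍ^n be a k-codimensional C¹_ℍ-regular submanifold with boundary in O and let p ∈ O ∩ ∂S. Suppose there exist an open set U ∋ p and two families of locally defining functions f₁,…,f_{k+1} ∈ C¹_ℍ(U) and g₁,…,g_{k+1} ∈ C¹_ℍ(U), each with linearly independent horizontal gradients on U, with U ∩ S = {f₁=⋯=f_k=0, f_{k+1}>0} = {g₁=⋯=g_k=0, g_{k+1}>0} and f_{k+1}(p)=g_{k+1}(p)=0. Then there exists a constant C > 0 such that (d_ℍ f_{k+1})_p = C (d_ℍ g_{k+1})_p on the tangent cone T^ℍ_p S. -/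

import Mathlib

open MeasureTheory Topology Filter Set ENNReal

noncomputable section
namespace Heis

/-- Points of the `n`-th Heisenberg group `ℍⁿ ≡ ℝⁿ × ℝⁿ × ℝ`, `p = (x, y, t)`. -/
abbrev Hpt (n : ℕ) : Type := (Fin n → ℝ) × (Fin n → ℝ) × ℝ

variable {n : ℕ}

/-- The Heisenberg group operation. -/
def hmul (p q : Hpt n) : Hpt n :=
  (p.1 + q.1, p.2.1 + q.2.1,
    p.2.2 + q.2.2 + (∑ j, p.1 j * q.2.1 j) / 2 - (∑ j, q.1 j * p.2.1 j) / 2)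

/-- Group inverse. -/
def hinv (p : Hpt n) : Hpt n := (-p.1, -p.2.1, -p.2.2)

/-- Anisotropic dilations `δ_λ(x,y,t) = (λx, λy, λ²t)`. -/
def hdil (l : ℝ) (p : Hpt n) : Hpt n := (l • p.1, l • p.2.1, l ^ 2 * p.2.2)

/-- The value at `p` of the `j`-th left invariant frame field `X₁,…,Xₙ,Y₁,…,Yₙ,T`,
expressed in the coordinates of `ℝ^{2n+1}`. -/
def frameVec (j : Fin (2*n+1)) (p : Hpt n) : Hpt n :=
  if h : (j : ℕ) < n then
    (Pi.single (⟨j, h⟩ : Fin n) 1, 0, -(p.2.1 ⟨j, h⟩) / 2)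
  else if h' : (j : ℕ) < 2*n then
    (0, Pi.single (⟨(j:ℕ) - n, by omega⟩ : Fin n) 1, p.1 ⟨(j:ℕ) - n, by omega⟩ / 2)
  else (0, 0, 1)

/-- Inclusion of horizontal indices. -/
def hIdx (j : Fin (2*n)) : Fin (2*n+1) := Fin.castLE (by omega) j

/-- Horizontal gradient `∇_ℍ f = (X₁f,…,Xₙf,Y₁f,…,Yₙf)` (pointwise derivatives along the
horizontal left-invariant fields). -/
def gradH (f : Hpt n → ℝ) (p : Hpt n) : Fin (2*n) → ℝ :=
  fun j => lineDeriv ℝ f p (frameVec (hIdx j) p)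

/-- `f` is of class `C¹_ℍ` on `U`: it is continuous and its horizontal derivatives exist and
are (represented by) continuous functions on `U`. -/
structure IsC1H (U : Set (Hpt n)) (f : Hpt n → ℝ) : Prop where
  contOn : ContinuousOn f U
  ldiff : ∀ p ∈ U, ∀ j : Fin (2*n), LineDifferentiableAt ℝ f p (frameVec (hIdx j) p)
  contGrad : ∀ j : Fin (2*n), ContinuousOn (fun p => gradH f p j) U

/-- Horizontal gradient as a frame-coefficient vector in `ℝ^{2n+1}` (with zero `T`-component). -/
def gradF (f : Hpt n → ℝ) (q : Hpt n) : Fin (2*n+1) → ℝ :=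
  fun j => if h : (j:ℕ) < 2*n then gradH f q ⟨j, h⟩ else 0

/-- Horizontal derivative indexed by a natural number (0 outside the horizontal range). -/
def gradNat (f : Hpt n → ℝ) (q : Hpt n) (i : ℕ) : ℝ :=
  if h : i < 2*n then gradH f q ⟨i, h⟩ else 0

/-- The Pansu differential of a `C¹_ℍ` function: `d_ℍf_p(x,y,t) = Σⱼ(xⱼXⱼf(p) + yⱼYⱼf(p))`. -/
def pansuD (f : Hpt n → ℝ) (p : Hpt n) (q : Hpt n) : ℝ :=
  ∑ j : Fin n, (q.1 j * gradH f p ⟨(j:ℕ), by omega⟩ + q.2.1 j * gradH f p ⟨n + (j:ℕ), by omega⟩)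

/-- `S` is a `k`-codimensional `C¹_ℍ`-regular submanifold. -/
def IsC1HCodim (k : ℕ) (S : Set (Hpt n)) : Prop :=
  ∀ p ∈ S, ∃ U : Set (Hpt n), IsOpen U ∧ p ∈ U ∧
    ∃ f : Fin k → Hpt n → ℝ,
      (∀ i, IsC1H U (f i)) ∧
      (∀ q ∈ U, LinearIndependent ℝ (fun i => gradH (f i) q)) ∧
      S ∩ U = {q ∈ U | ∀ i, f i q = 0}

/-- `L : ℝ^k → ℍⁿ` is a group homomorphism. -/
def IsGroupHomH {k : ℕ} (L : (Fin k → ℝ) → Hpt n) : Prop :=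
  ∀ a b, L (a + b) = hmul (L a) (L b)

/-- Pansu differentiability of `f : ℝ^k → ℍⁿ` at `a`:
`δ_{1/λ}(f(a)⁻¹ ⬝ f(a + λb)) → L(b)` locally uniformly in `b`, with `L` a group homomorphism. -/
def HasPansuDerivAt {k : ℕ} (f : (Fin k → ℝ) → Hpt n) (L : (Fin k → ℝ) → Hpt n)
    (a : Fin k → ℝ) : Prop :=
  IsGroupHomH L ∧
    TendstoLocallyUniformly
      (fun (l : ℝ) (b : Fin k → ℝ) => hdil l⁻¹ (hmul (hinv (f a)) (f (a + l • b)))) L (𝓝[>] 0)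

/-- `S` is a `k`-dimensional (`k ≤ n`) `C¹_ℍ`-regular submanifold: locally the injective image
of an open set of `ℝ^k` under a continuously Pansu differentiable map with injective
Pansu differential. -/
def IsC1HDim (k : ℕ) (S : Set (Hpt n)) : Prop :=
  ∀ p ∈ S, ∃ U : Set (Hpt n), IsOpen U ∧ p ∈ U ∧
    ∃ V : Set (Fin k → ℝ), IsOpen V ∧
    ∃ (f : (Fin k → ℝ) → Hpt n) (Df : (Fin k → ℝ) → (Fin k → ℝ) → Hpt n),
      Set.InjOn f V ∧ Set.MapsTo f V U ∧
      (∀ a ∈ V, HasPansuDerivAt f (Df a) a ∧ Function.Injective (Df a)) ∧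
      (∀ b, ContinuousOn (fun a => Df a b) V) ∧
      S ∩ U = f '' V

/-- `C¹_ℍ`-regular submanifold of codimension `k`, for any `1 ≤ k ≤ 2n+1` (for `k ≥ n+1` this
means a low-dimensional submanifold of dimension `2n+1-k`). -/
def IsC1HSub (k : ℕ) (S : Set (Hpt n)) : Prop :=
  if k ≤ n then IsC1HCodim k S else IsC1HDim (2*n+1-k) S

/-! ## Distances and measures -/

/-- Open ball of a distance function. -/
def rawBall (d : Hpt n → Hpt n → ℝ) (p : Hpt n) (r : ℝ) : Set (Hpt n) := {q | d p q < r}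

/-- The gauge used to define the spherical Hausdorff measure of dimension `m` at scale `r`. -/
def sphGauge (d : Hpt n → Hpt n → ℝ) (m r : ℝ) (s : Set (Hpt n)) : ℝ≥0∞ :=
  ⨅ (c : Hpt n) (ρ : ℝ) (_ : 0 < ρ) (_ : ρ < r) (_ : s ⊆ rawBall d c ρ),
    ENNReal.ofReal ((2*ρ) ^ m)

/-- Spherical pre-measure at scale `r`. -/
def sphPre (d : Hpt n → Hpt n → ℝ) (m r : ℝ) : OuterMeasure (Hpt n) :=
  OuterMeasure.boundedBy (sphGauge d m r)

/-- The spherical Hausdorff outer measure `𝒮^m` associated with `d`. -/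
def sphOuter (d : Hpt n → Hpt n → ℝ) (m : ℝ) : OuterMeasure (Hpt n) :=
  ⨆ (r : ℝ) (_ : 0 < r), sphPre d m r

/-- A left invariant, homogeneous, rotationally invariant distance on `ℍⁿ`.
(The field `carat` records the — automatically true — fact that Borel sets are
Carathéodory measurable for the associated spherical measures.) -/
structure HomDist (n : ℕ) where
  d : Hpt n → Hpt n → ℝ
  symm : ∀ p q, d p q = d q p
  triangle : ∀ p q r, d p r ≤ d p q + d q r
  eq_iff : ∀ p q, d p q = 0 ↔ p = q
  leftInv : ∀ g p q, d (hmul g p) (hmul g q) = d p q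
  homog : ∀ l : ℝ, 0 < l → ∀ p q, d (hdil l p) (hdil l q) = l * d p q
  rotInv : ∀ p q : Hpt n,
    (∑ j, (p.1 j ^ 2 + p.2.1 j ^ 2)) = (∑ j, (q.1 j ^ 2 + q.2.1 j ^ 2)) →
    p.2.2 = q.2.2 → d 0 p = d 0 q
  carat : ∀ m : ℝ,
    (inferInstance : MeasurableSpace (Hpt n)) ≤ (sphOuter d m).caratheodory

/-- Open ball `U(p,r)` of a homogeneous distance. -/
def hball (D : HomDist n) (p : Hpt n) (r : ℝ) : Set (Hpt n) := rawBall D.d p r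

/-- The spherical Hausdorff measure `𝒮^m` of a homogeneous distance, as a measure. -/
def sphMeasure (D : HomDist n) (m : ℝ) : Measure (Hpt n) :=
  (sphOuter D.d m).toMeasure (D.carat m)

/-- `μ⌊A` is locally finite on `O`. -/
def LocFin (μ : Measure (Hpt n)) (A O : Set (Hpt n)) : Prop :=
  ∀ p ∈ O, ∃ U : Set (Hpt n), IsOpen U ∧ p ∈ U ∧ μ (A ∩ U) < ⊤

/-! ## Euclidean coordinates and Euclidean Hausdorff measures -/

/-- Realization of a coordinate vector `c ∈ ℝ^{2n+1}` as a point/tangent vector of `ℍⁿ`. -/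
def rE (c : Fin (2*n+1) → ℝ) : Hpt n :=
  (fun i => c ⟨(i:ℕ), by omega⟩, fun i => c ⟨n + (i:ℕ), by omega⟩, c ⟨2*n, by omega⟩)

/-- Coordinates of a point/tangent vector of `ℍⁿ` as a vector of `ℝ^{2n+1}`. -/
def toEc (q : Hpt n) : Fin (2*n+1) → ℝ := fun j =>
  if h : (j:ℕ) < n then q.1 ⟨j, h⟩
  else if h' : (j:ℕ) < 2*n then q.2.1 ⟨(j:ℕ) - n, by omega⟩
  else q.2.2

/-- Identification of `ℍⁿ` with the Euclidean space `ℝ^{2n+1}`. -/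
def ofE (q : EuclideanSpace ℝ (Fin (2*n+1))) : Hpt n := rE (fun j => q j)

/-- The `m`-dimensional Euclidean Hausdorff measure on `ℍⁿ ≡ ℝ^{2n+1}`. -/
def muE (n : ℕ) (m : ℝ) : Measure (Hpt n) :=
  Measure.map ofE (μH[m] : Measure (EuclideanSpace ℝ (Fin (2*n+1))))

/-! ## Multivectors -/

/-- Index sets for a basis of `Λ_k 𝔥`. -/
def IdxSet (n k : ℕ) := {s : Finset (Fin (2*n+1)) // s.card = k}

instance (n k : ℕ) : Fintype (IdxSet n k) := by unfold IdxSet; infer_instance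

/-- The increasing enumeration of an index set. -/
def idxTuple {k : ℕ} (s : IdxSet n k) (i : Fin k) : Fin (2*n+1) :=
  ((s.1.orderIsoOfFin s.2) i).1

/-- `k`-vectors, as coefficients with respect to the canonical basis of `Λ_k ℝ^{2n+1}`. -/
abbrev MVec (n k : ℕ) := IdxSet n k → ℝ

/-- The simple `k`-vector `v₁ ∧ ⋯ ∧ v_k`. -/
def simpleWedge {k : ℕ} (v : Fin k → (Fin (2*n+1) → ℝ)) : MVec n k :=
  fun s => Matrix.det (Matrix.of fun i j => v i (idxTuple s j))

/-- Degree cast for multivectors. -/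
def mvCast {a b : ℕ} (h : a = b) (t : MVec n a) : MVec n b :=
  fun s => t ⟨s.1, by rw [h]; exact s.2⟩

/-- Euclidean scalar product of coefficient vectors. -/
def dotC (a b : Fin (2*n+1) → ℝ) : ℝ := ∑ j, a j * b j

/-- Pairing `⟨t | η⟩` at `p` of a `k`-vector (in the left invariant frame `X₁,…,Yₙ,T`)
with a `k`-form. -/
def pairF {k : ℕ} (t : MVec n k) (p : Hpt n) (η : (Fin k → Hpt n) → ℝ) : ℝ :=
  ∑ s, t s * η (fun i => frameVec (idxTuple s i) p)

/-- The `j`-th coordinate basis vector of `ℝ^{2n+1}`. -/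
def coordC (j : Fin (2*n+1)) : Fin (2*n+1) → ℝ := fun j' => if j' = j then 1 else 0

/-- Pairing `⟨t | η⟩` of a `k`-vector (in the coordinate basis `∂x,∂y,∂t`) with a `k`-form. -/
def pairE {k : ℕ} (t : MVec n k) (η : (Fin k → Hpt n) → ℝ) : ℝ :=
  ∑ s, t s * η (fun i => rE (coordC (idxTuple s i)))

/-- Realization of a frame-coefficient vector as a tangent vector at `p`. -/
def rF (c : Fin (2*n+1) → ℝ) (p : Hpt n) : Hpt n := ∑ j, c j • frameVec j p

/-! ## Covectors and Heisenberg forms -/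

/-- `k`-covectors on `ℍⁿ`. -/
abbrev Cov (n k : ℕ) := AlternatingMap ℝ (Hpt n) ℝ (Fin k)

/-- Wedge product of covectors. -/
def cwedge {k l : ℕ} (α : Cov n k) (β : Cov n l) : Cov n (k + l) :=
  AlternatingMap.domDomCongr finSumFinEquiv
    ((TensorProduct.lid ℝ ℝ).toLinearMap.compAlternatingMap (AlternatingMap.domCoprod α β))

/-- Degree cast for covectors. -/
def covCast {a b : ℕ} (h : a = b) (α : Cov n a) : Cov n b :=
  AlternatingMap.domDomCongr (finCongr h) α

def projX (j : Fin n) : Hpt n →ₗ[ℝ] ℝ := (LinearMap.proj j).comp (LinearMap.fst ℝ _ _)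

def projY (j : Fin n) : Hpt n →ₗ[ℝ] ℝ :=
  (LinearMap.proj j).comp ((LinearMap.fst ℝ _ _).comp (LinearMap.snd ℝ _ _))

def projT : Hpt n →ₗ[ℝ] ℝ := (LinearMap.snd ℝ _ _).comp (LinearMap.snd ℝ _ _)

/-- The contact form `θ = dt + ½Σⱼ(yⱼdxⱼ − xⱼdyⱼ)` at `p`, as a linear functional. -/
def thetaLin (p : Hpt n) : Hpt n →ₗ[ℝ] ℝ :=
  projT + (2:ℝ)⁻¹ • (∑ j : Fin n, (p.2.1 j • projX j - p.1 j • projY j))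

/-- A linear functional as a `1`-covector. -/
def cov1 (L : Hpt n →ₗ[ℝ] ℝ) : Cov n 1 :=
  AlternatingMap.ofSubsingleton ℝ (Hpt n) ℝ (0 : Fin 1) L

/-- `θ` as a `1`-covector. -/
def thetaC (p : Hpt n) : Cov n 1 := cov1 (thetaLin p)

/-- `dθ = −Σⱼ dxⱼ∧dyⱼ` as a (constant) `2`-covector. -/
def dthetaC : Cov n 2 := -∑ j : Fin n, cwedge (cov1 (projX j)) (cov1 (projY j))

/-- Membership in the Rumin ideal `ℐ^k = {λ∧θ + μ∧dθ}` at the point `p`. -/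
def memI {k : ℕ} (p : Hpt n) (ω : Cov n k) : Prop :=
  ∃ (a : Cov n (k-1)) (ω₂ : Cov n k) (h1 : (k-1)+1 = k),
    ω = covCast h1 (cwedge a (thetaC p)) + ω₂ ∧
    (ω₂ = 0 ∨ ∃ (b : Cov n (k-2)) (h2 : (k-2)+2 = k), ω₂ = covCast h2 (cwedge b dthetaC))

/-- Membership in `𝒥^k = {λ : λ∧θ = λ∧dθ = 0}` at the point `p`. -/
def memJ {k : ℕ} (p : Hpt n) (ω : Cov n k) : Prop :=
  cwedge ω (thetaC p) = 0 ∧ cwedge ω dthetaC = 0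

/-- A compactly supported smooth Heisenberg `k`-form on `O` (for `k ≤ n` the values are
representatives of classes modulo `ℐ^k`; for `k ≥ n+1` they lie in `𝒥^k`). -/
structure IsHFormD (k : ℕ) (O : Set (Hpt n)) (ω : Hpt n → Cov n k) : Prop where
  smooth : ∀ v : Fin k → Hpt n, ContDiff ℝ (⊤ : ℕ∞) fun p => ω p v
  cptSupp : ∃ K : Set (Hpt n), IsCompact K ∧ K ⊆ O ∧ ∀ p ∉ K, ω p = 0
  vert : n + 1 ≤ k → ∀ p, memJ p (ω p)

/-- Exterior derivative (as a raw multilinear expression):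
`dω_p(v₀,…,v_k) = Σᵢ (−1)ⁱ ∂_{vᵢ}(q ↦ ω_q(v₀,…,v̂ᵢ,…,v_k))(p)`. -/
def extD {k : ℕ} (ω : Hpt n → Cov n k) (p : Hpt n) (v : Fin (k+1) → Hpt n) : ℝ :=
  ∑ i : Fin (k+1), (-1 : ℝ)^(i:ℕ) * fderiv ℝ (fun q => ω q (v ∘ i.succAbove)) p (v i)

/-- `η` is the Rumin operator `D` applied to `ω` (only meaningful in degree `k = n`):
`Dω = d(ω − θ∧β)` where `β = L⁻¹((dω)_{𝔥₁})`, i.e. `β` is horizontal and `β∧dθ` agrees with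
`dω` on horizontal vectors. -/
def IsRuminD {k : ℕ} (ω : Hpt n → Cov n k) (η : Hpt n → (Fin (k+1) → Hpt n) → ℝ) : Prop :=
  ∃ (β : Hpt n → Cov n (k-1)) (h1 : 1 + (k-1) = k) (h2 : (k-1)+2 = k+1),
    (∀ v, ContDiff ℝ (⊤ : ℕ∞) fun p => β p v) ∧
    (∀ (p : Hpt n) (v : Fin (k-1) → Hpt n) (i : Fin (k-1)),
      v i = ((0:Fin n → ℝ), (0:Fin n → ℝ), (1:ℝ)) → β p v = 0) ∧
    (∀ (p : Hpt n) (v : Fin (k+1) → Hpt n), (∀ i, thetaLin p (v i) = 0) →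
      extD ω p v = covCast h2 (cwedge (β p) dthetaC) v) ∧
    η = extD (fun p => ω p - covCast h1 (cwedge (thetaC p) (β p)))

/-- The Rumin differential `d_c`: the exterior derivative in degree `k ≠ n`, the second order
operator `D` in the critical degree `k = n`. -/
def IsDc {k : ℕ} (ω : Hpt n → Cov n k) (η : Hpt n → (Fin (k+1) → Hpt n) → ℝ) : Prop :=
  if k = n then IsRuminD ω η else η = extD ω

/-- Degree cast for raw forms. -/
def rawCast {a b : ℕ} (h : a = b) (η : (Fin a → Hpt n) → ℝ) : (Fin b → Hpt n) → ℝ :=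
  fun v => η (fun i => v (Fin.cast h i))

/-! ## Orientations and currents -/

/-- `t` is a unit tangent `m`-vector of the `k`-codimensional `C¹_ℍ` submanifold `S` at `p`,
i.e. `t = ±*n^ℍ_S(p)`: `t` is the wedge of an orthonormal basis of `ker d_ℍf_p`
(in the left invariant frame). -/
def IsHTangentVecAt (k m : ℕ) (S : Set (Hpt n)) (p : Hpt n) (t : MVec n m) : Prop :=
  ∃ (U : Set (Hpt n)) (f : Fin k → Hpt n → ℝ), IsOpen U ∧ p ∈ U ∧
    (∀ i, IsC1H U (f i)) ∧
    (∀ q ∈ U, LinearIndependent ℝ (fun i => gradH (f i) q)) ∧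
    S ∩ U = {q ∈ U | ∀ i, f i q = 0} ∧
    ∃ v : Fin m → (Fin (2*n+1) → ℝ),
      (∀ i j, dotC (v i) (v j) = if i = j then 1 else 0) ∧
      (∀ i l, dotC (v i) (gradF (f l) p) = 0) ∧
      t = simpleWedge v

/-- An orientation of a `k`-codimensional `C¹_ℍ` submanifold: a continuous global choice of
the unit tangent `(2n+1−k)`-vector `t^ℍ_S` (here of formal degree `m`). -/
def IsHOrient (k m : ℕ) (S : Set (Hpt n)) (t : Hpt n → MVec n m) : Prop :=
  ContinuousOn t S ∧ ∀ p ∈ S, IsHTangentVecAt k m S p (t p)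

/-- Classical Euclidean unit tangent `m`-vector at a point of an `m`-dimensional submanifold
(coefficients in the coordinate basis). -/
def IsEuclTangentVecAt (m : ℕ) (S : Set (Hpt n)) (p : Hpt n) (t : MVec n m) : Prop :=
  ∃ v : Fin m → (Fin (2*n+1) → ℝ),
    (∀ i j, dotC (v i) (v j) = if i = j then 1 else 0) ∧
    (∀ i, rE (v i) ∈ tangentConeAt ℝ S p) ∧ t = simpleWedge v

/-- Classical (Euclidean) orientation of a low-dimensional submanifold. -/
def IsEuclOrient (m : ℕ) (S : Set (Hpt n)) (t : Hpt n → MVec n m) : Prop :=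
  ContinuousOn t S ∧ ∀ p ∈ S, IsEuclTangentVecAt m S p (t p)

/-- The standard vertical subgroup `𝕎` of codimension `k`. -/
def Wstd (n k : ℕ) : Set (Hpt n) := {p | ∀ i : Fin n, (i:ℕ) < k → p.1 i = 0}

/-- Embedding realizing `𝕎` as a Euclidean space. -/
def wEmbed (n k : ℕ) (a : ({i : Fin n // k ≤ (i:ℕ)} → ℝ) × (Fin n → ℝ) × ℝ) : Hpt n :=
  (fun i => if h : k ≤ (i:ℕ) then a.1 ⟨i, h⟩ else 0, a.2.1, a.2.2)

/-- Lebesgue measure `ℒ^{2n+1−k}` on the vertical subgroup `𝕎`. -/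
def wLeb (n k : ℕ) : Measure (Hpt n) := Measure.map (wEmbed n k) volume

/-- The geometric constant
`C_{n,k} = (sup{ℒ^{2n+1−k}(𝕎 ∩ U(p,1)) : p ∈ U(0,1)})⁻¹`. -/
def CnkC (D : HomDist n) (k : ℕ) : ℝ :=
  (sSup {v : ℝ | ∃ p ∈ hball D 0 1, v = (wLeb n k (Wstd n k ∩ hball D p 1)).toReal})⁻¹

/-- The Heisenberg current `⟦S⟧` of an oriented `k`-codimensional (`k ≤ n`) submanifold:
`⟦S⟧(ω) = (1/C_{n,k}) ∫_S ⟨t^ℍ_S | ω⟩ d𝒮^{Q−k}`. -/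
def currF (D : HomDist n) (k : ℕ) (S : Set (Hpt n)) (t : Hpt n → MVec n (2*n+1-k))
    (η : Hpt n → (Fin (2*n+1-k) → Hpt n) → ℝ) : ℝ :=
  (CnkC D k)⁻¹ * ∫ p in S, pairF (t p) p (η p) ∂(sphMeasure D ((2*n+2 : ℝ) - (k : ℝ)))

/-- The current of an oriented low-dimensional (`m ≤ n`) submanifold: the classical integral
`⟦S⟧(ω) = ∫_S ⟨τ_S | ω⟩ d𝓗^m_E`. -/
def currE {n : ℕ} (m : ℕ) (S : Set (Hpt n)) (t : Hpt n → MVec n m)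
    (η : Hpt n → (Fin m → Hpt n) → ℝ) : ℝ :=
  ∫ p in S, pairE (t p) (η p) ∂(muE n (m : ℝ))

/-- The Heisenberg current of an oriented `m`-dimensional submanifold (any `m`). -/
def hCurr (D : HomDist n) (m : ℕ) (S : Set (Hpt n)) (t : Hpt n → MVec n m)
    (η : Hpt n → (Fin m → Hpt n) → ℝ) : ℝ :=
  if m ≤ n then currE m S t η
  else if h2 : m ≤ 2*n+1 then
    currF D (2*n+1-m) S (fun p => mvCast (by omega) (t p)) (fun p => rawCast (by omega) (η p))
  else 0

/-- Orientation of an `m`-dimensional submanifold (any `m`): Euclidean in low dimension,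
the continuous unit tangent field `t^ℍ_S` in low codimension. -/
def IsOrientS (m : ℕ) (S : Set (Hpt n)) (t : Hpt n → MVec n m) : Prop :=
  if m ≤ n then IsEuclOrient m S t else IsHOrient (2*n+1-m) m S t

/-! ## Submanifolds with boundary -/

/-- The boundary `∂S = S̄ ∖ S`. -/
def bdry (S : Set (Hpt n)) : Set (Hpt n) := closure S \ S

/-- `S` is a `k`-codimensional `C¹_ℍ`-regular submanifold with boundary in `O`. -/
def IsC1HSubWithBdry (D : HomDist n) (k : ℕ) (O : Set (Hpt n)) (S : Set (Hpt n)) : Prop :=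
  (O ∩ S).Nonempty ∧ IsC1HSub k (O ∩ S) ∧
  (O ∩ bdry S).Nonempty ∧ IsC1HSub (k+1) (O ∩ bdry S) ∧
  ∀ p ∈ O ∩ bdry S, ∃ U : Set (Hpt n), IsOpen U ∧ p ∈ U ∧
    ∃ S' : Set (Hpt n), S' ⊆ U ∧ IsC1HSub k S' ∧ U ∩ closure S ⊆ S' ∧
      ∀ r : ℝ, 0 < r → (hball D p r ∩ (S' \ closure S)).Nonempty

/-- A family `f₁,…,f_{k+1}` of local defining functions at a boundary point `p`, as in the
characterization of `k`-codimensional submanifolds with boundary: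
`U ∩ S = {f₁ = ⋯ = f_k = 0, f_{k+1} > 0}` and `f_{k+1}(p) = 0`. -/
def IsBdryFrame (k : ℕ) (S : Set (Hpt n)) (p : Hpt n) (U : Set (Hpt n))
    (f : Fin (k+1) → Hpt n → ℝ) : Prop :=
  IsOpen U ∧ p ∈ U ∧ (∀ i, IsC1H U (f i)) ∧
  (∀ q ∈ U, LinearIndependent ℝ (fun i => gradH (f i) q)) ∧
  U ∩ S = {q ∈ U | (∀ i : Fin k, f i.castSucc q = 0) ∧ 0 < f (Fin.last k) q} ∧
  f (Fin.last k) p = 0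

/-! ## Smooth and Euclidean submanifolds -/

/-- `S` is a smooth (Euclidean `C^∞`) submanifold of codimension `k`. -/
def IsSmoothCodim (k : ℕ) (S : Set (Hpt n)) : Prop :=
  ∀ p ∈ S, ∃ U : Set (Hpt n), IsOpen U ∧ p ∈ U ∧ ∃ f : Fin k → Hpt n → ℝ,
    (∀ i, ContDiff ℝ (⊤ : ℕ∞) (f i)) ∧
    (∀ q ∈ U, LinearIndependent ℝ (fun i => fderiv ℝ (f i) q)) ∧
    S ∩ U = {q ∈ U | ∀ i, f i q = 0}

/-- `S` is a Euclidean `C¹` submanifold of codimension `k`. -/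
def IsC1ECodim (k : ℕ) (S : Set (Hpt n)) : Prop :=
  ∀ p ∈ S, ∃ U : Set (Hpt n), IsOpen U ∧ p ∈ U ∧ ∃ f : Fin k → Hpt n → ℝ,
    (∀ i, ContDiff ℝ 1 (f i)) ∧
    (∀ q ∈ U, LinearIndependent ℝ (fun i => fderiv ℝ (f i) q)) ∧
    S ∩ U = {q ∈ U | ∀ i, f i q = 0}

/-- `M` is a Euclidean `k`-dimensional `C¹` submanifold with boundary (`M` closed in its
charts; boundary charts are half-spaces). -/
def IsC1EuclSubWithBdryDim (k : ℕ) (M : Set (Hpt n)) : Prop :=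
  ∀ p ∈ M, ∃ (V : Set (Fin k → ℝ)) (φ : (Fin k → ℝ) → Hpt n) (U : Set (Hpt n)) (a : Fin k → ℝ)
      (i₀ : Fin k),
    IsOpen V ∧ IsOpen U ∧ p ∈ U ∧ a ∈ V ∧ φ a = p ∧
    ContDiffOn ℝ 1 φ V ∧ Set.InjOn φ V ∧
    (∀ b ∈ V, Function.Injective (fderivWithin ℝ φ V b)) ∧
    (M ∩ U = φ '' (V ∩ {x | 0 ≤ x i₀}) ∨ M ∩ U = φ '' V)

/-! ## Isometries -/

/-- A rotation of the horizontal layer: a linear group automorphism commuting with dilations,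
preserving the vertical coordinate and the horizontal Euclidean norm. -/
def IsRotation (R : Hpt n → Hpt n) : Prop :=
  IsLinearMap ℝ R ∧ (∀ p q, R (hmul p q) = hmul (R p) (R q)) ∧
  (∀ l p, R (hdil l p) = hdil l (R p)) ∧
  (∀ p, (R p).2.2 = p.2.2) ∧
  (∀ p, (∑ j, ((R p).1 j ^ 2 + (R p).2.1 j ^ 2)) = ∑ j, (p.1 j ^ 2 + p.2.1 j ^ 2))

/-- An isometry of `ℍⁿ`: the composition of a left translation and a rotation. -/
def IsHIsom (φ : Hpt n → Hpt n) : Prop :=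
  ∃ (g : Hpt n) (R : Hpt n → Hpt n), IsRotation R ∧ φ = fun p => hmul g (R p)

/-! ## Tangent cones and blow-ups -/

/-- The tangent cone `T^ℍ_0 E` at the origin. -/
def tangentConeH (E : Set (Hpt n)) : Set (Hpt n) :=
  {x | ∃ (xh : ℕ → Hpt n) (rh : ℕ → ℝ), (∀ h, xh h ∈ E) ∧ Tendsto rh atTop atTop ∧
        Tendsto (fun h => hdil (rh h) (xh h)) atTop (𝓝 x)}

/-- The tangent cone `T^ℍ_p E = T^ℍ_0(p⁻¹ ⬝ E)`. -/
def tangentConeHAt (E : Set (Hpt n)) (p : Hpt n) : Set (Hpt n) :=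
  tangentConeH ((fun q => hmul (hinv p) q) '' E)

/-- Local Hausdorff convergence of the sets `F l` to `E` as `l → 0⁺`, with respect to the
homogeneous distance `D`. -/
def LocHausConv (D : HomDist n) (F : ℝ → Set (Hpt n)) (E : Set (Hpt n)) : Prop :=
  ∀ (c : Hpt n) (R ε : ℝ), 0 < R → 0 < ε → ∃ l0 : ℝ, 0 < l0 ∧ ∀ l : ℝ, 0 < l → l < l0 →
    (∀ x ∈ F l ∩ {q | D.d c q ≤ R}, ∃ e ∈ E, D.d x e < ε) ∧
    (∀ x ∈ E ∩ {q | D.d c q ≤ R}, ∃ y ∈ F l, D.d x y < ε)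

/-! ## Induced orientation on the boundary -/

/-- `tB` is the value at `p ∈ ∂S` of the orientation induced on `∂S` by the orientation `tS`
of the `m`-dimensional submanifold with boundary `S`. -/
def InducedBdryOrientAt (D : HomDist n) (m : ℕ) (S : Set (Hpt n)) (p : Hpt n)
    (tS : MVec n m) (tB : MVec n (m-1)) : Prop :=
  if m ≤ n then
    -- low dimension: classical Euclidean induced orientation via the outward normal
    ∃ (νc : Fin (2*n+1) → ℝ) (w : Fin (m-1) → (Fin (2*n+1) → ℝ)) (h : (m-1)+1 = m),
      (∀ i j : Fin ((m-1)+1), dotC (Matrix.vecCons νc w i) (Matrix.vecCons νc w j) = if i = j then 1 else 0) ∧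
      rE νc ∉ tangentConeAt ℝ (closure S) p ∧
      -(rE νc) ∈ tangentConeAt ℝ (closure S) p ∧
      (∀ i, rE (w i) ∈ tangentConeAt ℝ (bdry S) p) ∧
      tB = simpleWedge w ∧ tS = mvCast h (simpleWedge (Matrix.vecCons νc w))
  else if m = n+1 then
    -- critical codimension: `±T ∧ τ_{∂S} = t^ℍ_S` according to whether `S` lies below/above ∂S
    ∃ (U : Set (Hpt n)) (f : Fin n → Hpt n → ℝ), IsOpen U ∧ p ∈ U ∧
      (∀ i, IsC1H U (f i)) ∧ (∀ q ∈ U, LinearIndependent ℝ (fun i => gradH (f i) q)) ∧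
      U ∩ closure S ⊆ {q ∈ U | ∀ i, f i q = 0} ∧
      (∀ r : ℝ, 0 < r →
        (hball D p r ∩ ({q ∈ U | ∀ i, f i q = 0} \ closure S)).Nonempty) ∧
      ∃ (ε : ℝ) (w : Fin (m-1) → (Fin (2*n+1) → ℝ)) (h : (m-1)+1 = m),
        (ε = 1 ∨ ε = -1) ∧
        (∀ i j, dotC (w i) (w j) = if i = j then 1 else 0) ∧
        (∀ i, w i ⟨2*n, by omega⟩ = 0) ∧
        (∀ i, rF (w i) p ∈ tangentConeAt ℝ (bdry S) p) ∧
        -- `ε = −1` iff `S` lies above its boundary around `p`: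
        -- the blow-up of `S` at `p` is the corresponding open half of `T^ℍ_pS`
        LocHausConv D (fun l => (fun q => hdil l⁻¹ (hmul (hinv p) q)) '' S)
          ({v | ∀ i, pansuD (f i) p v = 0} ∩ {q | 0 < (-ε) * q.2.2}) ∧
        tB = simpleWedge (fun i => toEc (rF (w i) p)) ∧
        tS = mvCast h (simpleWedge (Matrix.vecCons (fun j => if (j:ℕ) = 2*n then ε else 0) w))
  else
    -- non-critical low codimension: `ν_{∂S} ∧ t^ℍ_{∂S} = t^ℍ_S` with `ν` the outward normal
    ∃ (U : Set (Hpt n)) (f : Fin (2*n+1-m+1) → Hpt n → ℝ),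
      IsBdryFrame (2*n+1-m) S p U f ∧
      ∃ (νc : Fin (2*n+1) → ℝ) (w : Fin (m-1) → (Fin (2*n+1) → ℝ)) (h : (m-1)+1 = m),
        (∀ i j : Fin ((m-1)+1), dotC (Matrix.vecCons νc w i) (Matrix.vecCons νc w j) = if i = j then 1 else 0) ∧
        (∀ i : Fin (2*n+1-m), pansuD (f i.castSucc) p (rE νc) = 0) ∧
        pansuD (f (Fin.last (2*n+1-m))) p (rE νc) < 0 ∧
        (∀ i, ∀ l : Fin (2*n+1-m+1), pansuD (f l) p (rE (w i)) = 0) ∧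
        tB = simpleWedge w ∧ tS = mvCast h (simpleWedge (Matrix.vecCons νc w))

/-! ## Miscellaneous -/

/-- The projection `π_p(q) = Σⱼ xⱼXⱼ(p) + Σⱼ yⱼYⱼ(p) ∈ H_pℍⁿ`. -/
def piProj (p q : Hpt n) : Hpt n :=
  (∑ j : Fin n, q.1 j • frameVec ⟨(j:ℕ), by omega⟩ p) +
  (∑ j : Fin n, q.2.1 j • frameVec ⟨n + (j:ℕ), by omega⟩ p)

/-- The norm `|·|_p` on the horizontal fibre `H_pℍⁿ` making `X₁(p),…,Yₙ(p)` orthonormal. -/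
def hnormAt (_p : Hpt n) (v : Hpt n) : ℝ :=
  Real.sqrt (∑ j, ((v.1 j) ^ 2 + (v.2.1 j) ^ 2))

/-- The left-invariant scalar product making `X₁,…,Yₙ,T` orthonormal. -/
def dotH (v w : Hpt n) : ℝ :=
  (∑ j, v.1 j * w.1 j) + (∑ j, v.2.1 j * w.2.1 j) + v.2.2 * w.2.2

/-! ## Auxiliary material for the proof -/

/-- The horizontal frame field `W_j`. -/
def Wv (j : Fin (2*n)) (q : Hpt n) : Hpt n := frameVec (hIdx j) q

theorem Wv_move (j : Fin (2*n)) (q : Hpt n) (s : ℝ) : Wv j (q + s • Wv j q) = Wv j q := by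
  unfold Wv frameVec
  by_cases h : ((hIdx j : Fin (2*n+1)) : ℕ) < n
  · simp [h]
  · have h' : ((hIdx j : Fin (2*n+1)) : ℕ) < 2*n := j.2
    simp [h, h']

theorem Wv_norm (j : Fin (2*n)) (q : Hpt n) : ‖Wv j q‖ ≤ 1 + ‖q‖ := by
  unfold Wv frameVec
  have hq1 : ‖q.1‖ ≤ ‖q‖ := norm_fst_le q
  have hq2 : ‖q.2.1‖ ≤ ‖q‖ := (norm_fst_le q.2).trans (norm_snd_le q)
  have h0 : 0 ≤ ‖q‖ := norm_nonneg q
  by_cases h : ((hIdx j : Fin (2*n+1)) : ℕ) < n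
  · simp only [h, dite_true]
    have h2 := (norm_le_pi_norm q.2.1 ⟨_, h⟩).trans hq2
    rw [Prod.norm_def, Prod.norm_def]
    refine max_le ?_ (max_le ?_ ?_)
    · simp only [Pi.norm_single, norm_one, norm_zero]; linarith
    · simp only [Pi.norm_single, norm_one, norm_zero]; linarith
    · simp only [norm_neg, norm_div, Real.norm_ofNat]; linarith
  · have h' : ((hIdx j : Fin (2*n+1)) : ℕ) < 2*n := j.2
    simp only [h, h', dite_true, dite_false]
    have h2 := (norm_le_pi_norm q.1 ⟨((hIdx j : Fin (2*n+1)) : ℕ) - n, by omega⟩).trans hq1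
    rw [Prod.norm_def, Prod.norm_def]
    refine max_le ?_ (max_le ?_ ?_)
    · simp only [Pi.norm_single, norm_one, norm_zero]; linarith
    · simp only [Pi.norm_single, norm_one, norm_zero]; linarith
    · simp only [norm_neg, norm_div, Real.norm_ofNat]; linarith

/-- Mean value estimate along one horizontal frame direction. -/
theorem step_est {U : Set (Hpt n)} {f : Hpt n → ℝ} (hf : IsC1H U f) {p : Hpt n} {r B η : ℝ}
    (hU : Metric.ball p r ⊆ U) (hB : ∀ q ∈ Metric.ball p r, ∀ j, ‖Wv j q‖ ≤ B)
    (hη : ∀ q ∈ Metric.ball p r, ∀ j, |gradH f q j - gradH f p j| ≤ η)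
    (q : Hpt n) (j : Fin (2*n)) (s : ℝ) (hq : dist q p + B * |s| < r) (hB0 : 0 ≤ B) :
    |f (q + s • Wv j q) - f q - s * gradH f p j| ≤ η * |s| := by
  have hqb : q ∈ Metric.ball p r := by
    rw [Metric.mem_ball]; nlinarith [mul_nonneg hB0 (abs_nonneg s)]
  have hin : ∀ t ∈ uIcc 0 s, q + t • Wv j q ∈ Metric.ball p r := by
    intro t ht
    have hts : |t| ≤ |s| := by
      have := abs_sub_left_of_mem_uIcc ht
      simpa using this
    rw [Metric.mem_ball]
    calc dist (q + t • Wv j q) p ≤ dist (q + t • Wv j q) q + dist q p := dist_triangle _ _ _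
      _ = |t| * ‖Wv j q‖ + dist q p := by simp [dist_eq_norm, norm_smul]
      _ ≤ |s| * B + dist q p := by
          gcongr
          exact hB q hqb j
      _ < r := by linarith
  have hd : ∀ t ∈ uIcc 0 s, HasDerivWithinAt (fun t => f (q + t • Wv j q) - t * gradH f p j)
      (gradH f (q + t • Wv j q) j - gradH f p j) (uIcc 0 s) t := by
    intro t ht
    apply HasDerivAt.hasDerivWithinAt
    have h1 := (hf.ldiff _ (hU (hin t ht)) j).hasLineDerivAt
    have h2 : HasDerivAt (fun u : ℝ => f (q + t • Wv j q + u • Wv j q))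
        (gradH f (q + t • Wv j q) j) 0 := by
      have e := Wv_move j q t
      unfold HasLineDerivAt at h1
      change HasDerivAt (fun u : ℝ => f (q + t • Wv j q + u • Wv j (q + t • Wv j q))) _ 0 at h1
      rw [e] at h1
      exact h1
    have h3 : HasDerivAt (fun u : ℝ => f (q + u • Wv j q)) (gradH f (q + t • Wv j q) j) t := by
      have h2' : HasDerivAt (fun u : ℝ => f (q + t • Wv j q + u • Wv j q))
        (gradH f (q + t • Wv j q) j) (t - t) := by simpa using h2
      have := HasDerivAt.comp_sub_const t t h2'
      refine this.congr_of_eventuallyEq (Eventually.of_forall fun u => ?_)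
      simp only [add_assoc, ← add_smul]
      congr 3
      ring
    have h4 : HasDerivAt (fun u : ℝ => u * gradH f p j) (gradH f p j) t := by
      simpa using (hasDerivAt_id t).mul_const (gradH f p j)
    exact h3.sub h4
  have := Convex.norm_image_sub_le_of_norm_hasDerivWithin_le (C := η) hd
    (fun t ht => hη _ (hin t ht) j) (convex_uIcc 0 s) left_mem_uIcc right_mem_uIcc
  simp only [Real.norm_eq_abs, zero_smul, add_zero, zero_mul, sub_zero] at this
  convert this using 2
  ring

/-- Successive moves along the frame directions of a list. -/
def moves (c : Fin (2*n) → ℝ) : List (Fin (2*n)) → Hpt n → Hpt n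
  | [], q => q
  | j :: l, q => moves c l (q + c j • Wv j q)

theorem moves_dist {p : Hpt n} {r B : ℝ} (hB : ∀ q ∈ Metric.ball p r, ∀ j, ‖Wv j q‖ ≤ B)
    (hB0 : 0 ≤ B) (c : Fin (2*n) → ℝ) (l : List (Fin (2*n))) :
    ∀ q, dist q p + B * (l.map fun j => |c j|).sum < r →
      dist (moves c l q) q ≤ B * (l.map fun j => |c j|).sum := by
  induction l with
  | nil => intro q _; simp [moves]
  | cons j l ih =>
    intro q hq
    have hs : 0 ≤ (l.map fun j => |c j|).sum :=
      List.sum_nonneg (by simp only [List.mem_map]; rintro _ ⟨a, _, rfl⟩; exact abs_nonneg _)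
    simp only [List.map_cons, List.sum_cons, moves] at *
    have hqb : q ∈ Metric.ball p r := by
      rw [Metric.mem_ball]; nlinarith [mul_nonneg hB0 (add_nonneg (abs_nonneg (c j)) hs)]
    have h1 : dist (q + c j • Wv j q) q ≤ B * |c j| := by
      simp only [dist_eq_norm, add_sub_cancel_left, norm_smul, Real.norm_eq_abs]
      rw [mul_comm]
      gcongr
      exact hB q hqb j
    have h2 := dist_triangle (q + c j • Wv j q) q p
    have h3 := ih (q + c j • Wv j q) (by linarith)
    have h4 := dist_triangle (moves c l (q + c j • Wv j q)) (q + c j • Wv j q) q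
    linarith

theorem moves_est {U : Set (Hpt n)} {f : Hpt n → ℝ} (hf : IsC1H U f) {p : Hpt n} {r B η : ℝ}
    (hU : Metric.ball p r ⊆ U) (hB : ∀ q ∈ Metric.ball p r, ∀ j, ‖Wv j q‖ ≤ B)
    (hη : ∀ q ∈ Metric.ball p r, ∀ j, |gradH f q j - gradH f p j| ≤ η)
    (hB0 : 0 ≤ B) (c : Fin (2*n) → ℝ) (l : List (Fin (2*n))) :
    ∀ q, dist q p + B * (l.map fun j => |c j|).sum < r →
      |f (moves c l q) - f q - (l.map fun j => c j * gradH f p j).sum|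
        ≤ η * (l.map fun j => |c j|).sum := by
  induction l with
  | nil => intro q _; simp [moves]
  | cons j l ih =>
    intro q hq
    have hs : 0 ≤ (l.map fun j => |c j|).sum :=
      List.sum_nonneg (by simp only [List.mem_map]; rintro _ ⟨a, _, rfl⟩; exact abs_nonneg _)
    simp only [List.map_cons, List.sum_cons, moves] at *
    have hBs := mul_nonneg hB0 hs
    have hBc := mul_nonneg hB0 (abs_nonneg (c j))
    have hqb : q ∈ Metric.ball p r := by
      rw [Metric.mem_ball]; nlinarith
    have h1 : dist (q + c j • Wv j q) q ≤ B * |c j| := by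
      simp only [dist_eq_norm, add_sub_cancel_left, norm_smul, Real.norm_eq_abs]
      rw [mul_comm]
      gcongr
      exact hB q hqb j
    have h2 := dist_triangle (q + c j • Wv j q) q p
    have h3 := ih (q + c j • Wv j q) (by linarith)
    have h4 := step_est hf hU hB hη q j (c j) (by linarith) hB0
    rw [abs_le] at *
    constructor <;> linarith [h3.1, h3.2, h4.1, h4.2]

/-- The move with all the frame directions. -/
def mv (c : Fin (2*n) → ℝ) (q : Hpt n) : Hpt n := moves c (List.finRange (2*n)) q

theorem mv_dist {p : Hpt n} {r B : ℝ} (hB : ∀ q ∈ Metric.ball p r, ∀ j, ‖Wv j q‖ ≤ B)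
    (hB0 : 0 ≤ B) (c : Fin (2*n) → ℝ) (q : Hpt n) (hq : dist q p + B * ∑ j, |c j| < r) :
      dist (mv c q) q ≤ B * ∑ j, |c j| := by
  have := moves_dist hB hB0 c (List.finRange (2*n)) q
  rw [← List.ofFn_eq_map, List.sum_ofFn] at this
  exact this hq

theorem mv_est {U : Set (Hpt n)} {f : Hpt n → ℝ} (hf : IsC1H U f) {p : Hpt n} {r B η : ℝ}
    (hU : Metric.ball p r ⊆ U) (hB : ∀ q ∈ Metric.ball p r, ∀ j, ‖Wv j q‖ ≤ B)
    (hη : ∀ q ∈ Metric.ball p r, ∀ j, |gradH f q j - gradH f p j| ≤ η)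
    (hB0 : 0 ≤ B) (c : Fin (2*n) → ℝ) (q : Hpt n) (hq : dist q p + B * ∑ j, |c j| < r) :
    |f (mv c q) - f q - ∑ j, c j * gradH f p j| ≤ η * ∑ j, |c j| := by
  have := moves_est hf hU hB hη hB0 c (List.finRange (2*n)) q
  rw [← List.ofFn_eq_map, List.sum_ofFn, ← List.ofFn_eq_map, List.sum_ofFn] at this
  exact this hq

theorem exists_right_inv {m N : ℕ} (M : Fin m → Fin N → ℝ) (hM : LinearIndependent ℝ M) :
    ∃ (A : (Fin m → ℝ) → (Fin N → ℝ)) (K : ℝ), 0 < K ∧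
      (∀ y i, ∑ j, A y j * M i j = y i) ∧ ∀ y, ∑ j, |A y j| ≤ K * ‖y‖ := by
  have hr := LinearIndependent.rank_matrix (M := Matrix.of M) hM
  have hs : LinearMap.range (Matrix.of M).mulVecLin = ⊤ := by
    apply Submodule.eq_top_of_finrank_eq
    rw [Matrix.rank] at hr
    rw [hr]; simp
  obtain ⟨A, hA⟩ := LinearMap.exists_rightInverse_of_surjective _ hs
  refine ⟨A, N * ‖LinearMap.toContinuousLinearMap A‖ + 1, by positivity, ?_, ?_⟩
  · intro y i
    have := congrFun (LinearMap.congr_fun hA y) i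
    simp only [LinearMap.comp_apply, Matrix.mulVecLin_apply, LinearMap.id_apply] at this
    rw [← this]
    simp [Matrix.mulVec, dotProduct, mul_comm]
  · intro y
    have h1 : ‖A y‖ ≤ ‖LinearMap.toContinuousLinearMap A‖ * ‖y‖ :=
      (LinearMap.toContinuousLinearMap A).le_opNorm y
    calc ∑ j, |A y j| ≤ ∑ j : Fin N, ‖A y‖ :=
          Finset.sum_le_sum fun j _ => norm_le_pi_norm (A y) j
      _ = N * ‖A y‖ := by simp
      _ ≤ N * (‖LinearMap.toContinuousLinearMap A‖ * ‖y‖) := by gcongr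
      _ ≤ _ := by nlinarith [norm_nonneg y]

set_option maxHeartbeats 1000000 in
/-- Lyusternik–Graves type solvability along horizontal moves. -/
theorem solve_core {m : ℕ} {U : Set (Hpt n)} {p : Hpt n} (hUo : IsOpen U) (hp : p ∈ U)
    (f g : Fin m → Hpt n → ℝ) (hf : ∀ i, IsC1H U (f i)) (hg : ∀ i, IsC1H U (g i))
    (hli : LinearIndependent ℝ (fun i => gradH (f i) p))
    (c : Fin (2*n) → ℝ) (δ : ℝ) (hδ : 0 < δ) :
    ∃ ε : ℝ, 0 < ε ∧ ∃ q ∈ U,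
      (∀ i, f i q = f i p + ε * ∑ j, c j * gradH (f i) p j) ∧
      (∀ i, |g i q - g i p - ε * ∑ j, c j * gradH (g i) p j| ≤ δ * ε) := by
  obtain ⟨A, K, hK, hA, hAK⟩ := exists_right_inv _ hli
  set L : ℝ := ∑ j, |c j| with hL
  have hL0 : 0 ≤ L := Finset.sum_nonneg fun _ _ => abs_nonneg _
  -- bound on the gradients of g
  obtain ⟨G, hG0, hG⟩ : ∃ G : ℝ, 0 ≤ G ∧ ∀ i j, |gradH (g i) p j| ≤ G := by
    refine ⟨∑ i, ∑ j, |gradH (g i) p j|, by positivity, fun i j => ?_⟩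
    calc |gradH (g i) p j| ≤ ∑ j, |gradH (g i) p j| :=
          Finset.single_le_sum (f := fun j => |gradH (g i) p j|) (fun _ _ => abs_nonneg _) (Finset.mem_univ j)
      _ ≤ _ := Finset.single_le_sum (f := fun i => ∑ j, |gradH (g i) p j|)
          (fun _ _ => Finset.sum_nonneg fun _ _ => abs_nonneg _) (Finset.mem_univ i)
  -- choice of η
  obtain ⟨η, hη0, hη1, hηK, hηδ⟩ : ∃ η : ℝ, 0 < η ∧ η ≤ 1 ∧ η * K ≤ 1/2 ∧
      η * (L * (1 + (G + 1) * (2 * K))) ≤ δ := by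
    set M := L * (1 + (G + 1) * (2 * K)) with hM
    have hM0 : 0 ≤ M := by positivity
    refine ⟨min 1 (min (1/(2*K)) (δ/(M+1))), by positivity, min_le_left _ _, ?_, ?_⟩
    · calc _ ≤ (1/(2*K)) * K := by
            gcongr
            exact (min_le_right _ _).trans (min_le_left _ _)
        _ = 1/2 := by field_simp
    · calc _ ≤ (δ/(M+1)) * M := by
            gcongr
            exact (min_le_right _ _).trans (min_le_right _ _)
        _ ≤ (δ/(M+1)) * (M+1) := by gcongr; linarith
        _ = δ := by field_simp
  -- choice of r
  have hev : ∀ h : Fin m → Hpt n → ℝ, (∀ i, IsC1H U (h i)) →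
      ∀ᶠ q in 𝓝 p, ∀ i j, |gradH (h i) q j - gradH (h i) p j| ≤ η := by
    intro h hh
    rw [eventually_all]; intro i
    rw [eventually_all]; intro j
    have := ((hh i).contGrad j).continuousAt (hUo.mem_nhds hp)
    filter_upwards [Metric.tendsto_nhds.1 this η hη0] with q hq
    exact le_of_lt hq
  obtain ⟨r₀, hr₀, hr₀'⟩ := Metric.eventually_nhds_iff_ball.1
    ((hev f hf).and ((hev g hg).and (hUo.mem_nhds hp)))
  set r := min r₀ 1 with hr
  have hrpos : 0 < r := by positivity
  have hsub : ∀ q ∈ Metric.ball p r, q ∈ Metric.ball p r₀ := fun q hq =>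
    Metric.ball_subset_ball (min_le_left _ _) hq
  have hU : Metric.ball p r ⊆ U := fun q hq => (hr₀' q (hsub q hq)).2.2
  have hηf : ∀ i, ∀ q ∈ Metric.ball p r, ∀ j, |gradH (f i) q j - gradH (f i) p j| ≤ η :=
    fun i q hq => (hr₀' q (hsub q hq)).1 i
  have hηg : ∀ i, ∀ q ∈ Metric.ball p r, ∀ j, |gradH (g i) q j - gradH (g i) p j| ≤ η :=
    fun i q hq => (hr₀' q (hsub q hq)).2.1 i
  set B : ℝ := 2 + ‖p‖ with hBdef
  have hB0 : 0 ≤ B := by positivity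
  have hB : ∀ q ∈ Metric.ball p r, ∀ j, ‖Wv j q‖ ≤ B := by
    intro q hq j
    have h1 : dist q p < 1 := lt_of_lt_of_le (Metric.mem_ball.1 hq) (min_le_right _ _)
    rw [dist_eq_norm] at h1
    have h2 : ‖q‖ ≤ ‖q - p‖ + ‖p‖ := by simpa using norm_add_le (q - p) p
    linarith [Wv_norm j q]
  -- choice of ε
  obtain ⟨ε, hε, hεr⟩ : ∃ ε : ℝ, 0 < ε ∧ B * (2 * (ε * L)) < r := by
    refine ⟨r / (2 * (B * (2 * L) + 1)), by positivity, ?_⟩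
    have : B * (2 * (r / (2 * (B * (2 * L) + 1)) * L))
        = (r/2) * ((B * (2 * L)) / (B * (2 * L) + 1)) := by field_simp
    rw [this]
    have h1 : (B * (2 * L)) / (B * (2 * L) + 1) ≤ 1 := by
      rw [div_le_one (by positivity)]; linarith
    nlinarith
  set Λ : ℝ := ε * L with hΛ
  have hΛ0 : 0 ≤ Λ := by positivity
  refine ⟨ε, hε, ?_⟩
  -- the error and the iteration
  let e : Hpt n → Fin m → ℝ := fun q i =>
    f i p + ε * ∑ j, c j * gradH (f i) p j - f i q
  let q : ℕ → Hpt n := fun k => Nat.rec (mv (fun j => ε * c j) p) (fun _ x => mv (A (e x)) x) k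
  have hq0 : q 0 = mv (fun j => ε * c j) p := rfl
  have hqs : ∀ k, q (k+1) = mv (A (e (q k))) (q k) := fun k => rfl
  have hεc : ∑ j, |ε * c j| = Λ := by
    simp [abs_mul, abs_of_pos hε, hΛ, hL, Finset.mul_sum]
  have hεs : ∀ h : Fin m → Hpt n → ℝ, ∀ i, ∑ j, ε * c j * gradH (h i) p j
      = ε * ∑ j, c j * gradH (h i) p j := by
    intro h i; simp [Finset.mul_sum, mul_assoc]
  have hBΛ : 0 ≤ B * Λ := by positivity
  have hηKΛ : 2 * (K * (η * Λ)) ≤ Λ := by nlinarith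
  have hBK : B * (2 * (K * (η * Λ))) ≤ B * Λ := mul_le_mul_of_nonneg_left hηKΛ hB0
  have hX0 : 0 ≤ K * (η * Λ) := by positivity
  have key : ∀ k, ‖e (q k)‖ ≤ (1/2:ℝ)^k * (η * Λ) ∧
      dist (q k) p ≤ B * (Λ + 2 * (K * (η * Λ)) * (1 - (1/2:ℝ)^k)) ∧
      (∀ i, |g i (q k) - g i p - ε * ∑ j, c j * gradH (g i) p j| ≤
        η * Λ + (G + η) * (2 * (K * (η * Λ)) * (1 - (1/2:ℝ)^k))) ∧
      ∑ j, |A (e (q k)) j| ≤ K * ((1/2:ℝ)^k * (η * Λ)) ∧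
      dist (q k) p + B * ∑ j, |A (e (q k)) j| < r := by
    have aux : ∀ k, ‖e (q k)‖ ≤ (1/2:ℝ)^k * (η * Λ) →
      dist (q k) p ≤ B * (Λ + 2 * (K * (η * Λ)) * (1 - (1/2:ℝ)^k)) →
      ∑ j, |A (e (q k)) j| ≤ K * ((1/2:ℝ)^k * (η * Λ)) ∧
      dist (q k) p + B * ∑ j, |A (e (q k)) j| < r := by
      intro k h1 h2
      have h3 : ∑ j, |A (e (q k)) j| ≤ K * ((1/2:ℝ)^k * (η * Λ)) :=
        (hAK _).trans (mul_le_mul_of_nonneg_left h1 hK.le)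
      refine ⟨h3, ?_⟩
      have h4 := mul_le_mul_of_nonneg_left h3 hB0
      have h5 : 0 ≤ B * (K * ((1/2:ℝ)^k * (η * Λ))) := by positivity
      nlinarith
    intro k
    induction k with
    | zero =>
      have hin : dist p p + B * ∑ j, |ε * c j| < r := by
        rw [hεc, dist_self]; linarith
      have h1 : ‖e (q 0)‖ ≤ (1/2:ℝ)^0 * (η * Λ) := by
        rw [pow_zero, one_mul, pi_norm_le_iff_of_nonneg (by positivity)]
        intro i
        have := mv_est (hf i) hU hB (hηf i) hB0 (fun j => ε * c j) p hin
        simp only [hεc, hεs f] at this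
        rw [Real.norm_eq_abs, abs_sub_comm]
        convert this using 2
        rw [hq0]; ring
      have h2 : dist (q 0) p ≤ B * (Λ + 2 * (K * (η * Λ)) * (1 - (1/2:ℝ)^0)) := by
        have := mv_dist hB hB0 (fun j => ε * c j) p hin
        simp only [hεc] at this
        simpa [hq0] using this
      refine ⟨h1, h2, fun i => ?_, aux 0 h1 h2⟩
      have := mv_est (hg i) hU hB (hηg i) hB0 (fun j => ε * c j) p hin
      simp only [hεc, hεs g] at this
      simpa [hq0] using this
    | succ k ih =>
      obtain ⟨i1, i2, i3, i4, i5⟩ := ih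
      set P : ℝ := (1/2:ℝ)^k with hP
      have hPs : (1/2:ℝ)^(k+1) = P/2 := by rw [pow_succ, hP]; ring
      have hP0 : 0 < P := by positivity
      have h1 : ‖e (q (k+1))‖ ≤ (1/2:ℝ)^(k+1) * (η * Λ) := by
        rw [pi_norm_le_iff_of_nonneg (by positivity)]
        intro i
        have := mv_est (hf i) hU hB (hηf i) hB0 _ _ i5
        rw [hA, ← hqs] at this
        rw [Real.norm_eq_abs, abs_sub_comm]
        have h6 : η * ∑ j, |A (e (q k)) j| ≤ (1/2:ℝ)^(k+1) * (η * Λ) := by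
          calc _ ≤ η * (K * (P * (η * Λ))) := by gcongr
            _ = (η * K) * (P * (η * Λ)) := by ring
            _ ≤ (1/2) * (P * (η * Λ)) := by gcongr
            _ = _ := by rw [hPs]; ring
        refine le_trans (le_of_eq ?_) (this.trans h6)
        congr 1
        simp only [e]; ring
      have h2 : dist (q (k+1)) p ≤ B * (Λ + 2 * (K * (η * Λ)) * (1 - (1/2:ℝ)^(k+1))) := by
        have h3 := mv_dist hB hB0 _ _ i5
        rw [← hqs] at h3
        have h4 := dist_triangle (q (k+1)) (q k) p
        have h5 := mul_le_mul_of_nonneg_left i4 hB0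
        rw [hPs]
        nlinarith
      refine ⟨h1, h2, fun i => ?_, aux (k+1) h1 h2⟩
      have h3 := mv_est (hg i) hU hB (hηg i) hB0 _ _ i5
      rw [← hqs] at h3
      have h4 : |∑ j, A (e (q k)) j * gradH (g i) p j| ≤ G * ∑ j, |A (e (q k)) j| := by
        rw [Finset.mul_sum]
        refine (Finset.abs_sum_le_sum_abs _ _).trans (Finset.sum_le_sum fun j _ => ?_)
        rw [abs_mul, mul_comm]
        exact mul_le_mul_of_nonneg_right (hG i j) (abs_nonneg _)
      have h5 := mul_le_mul_of_nonneg_left i4 (add_nonneg hG0 hη0.le)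
      have h6 := i3 i
      rw [hPs]
      have h7 : η * Λ + (G + η) * (2 * (K * (η * Λ)) * (1 - P / 2)) =
        η * Λ + (G + η) * (2 * (K * (η * Λ)) * (1 - P)) + (G + η) * (K * (P * (η * Λ))) := by ring
      rw [h7]
      rw [abs_le] at *
      constructor <;> linarith [h3.1, h3.2, h4.1, h4.2, h6.1, h6.2]
  -- convergence
  have hdist : ∀ k, dist (q k) (q (k+1)) ≤ (B * (K * (η * Λ))) * (1/2:ℝ)^k := by
    intro k
    obtain ⟨i1, i2, i3, i4, i5⟩ := key k
    have h3 := mv_dist hB hB0 _ _ i5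
    rw [← hqs, dist_comm] at h3
    have h5 := mul_le_mul_of_nonneg_left i4 hB0
    linarith
  obtain ⟨x, hx⟩ := cauchySeq_tendsto_of_complete
    (cauchySeq_of_le_geometric (1/2) _ (by norm_num) hdist)
  have hkd : ∀ k, dist (q k) p ≤ B * (2 * Λ) := by
    intro k
    have h2 := (key k).2.1
    have : (0:ℝ) < (1/2)^k := by positivity
    nlinarith [mul_nonneg hB0 (mul_nonneg hX0 this.le)]
  have hxp : dist x p ≤ B * (2 * Λ) :=
    le_of_tendsto (hx.dist tendsto_const_nhds) (Eventually.of_forall hkd)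
  have hxU : x ∈ U := hU (Metric.mem_ball.2 (lt_of_le_of_lt hxp hεr))
  have hfx : ∀ h : Fin m → Hpt n → ℝ, (∀ i, IsC1H U (h i)) → ∀ i,
      Tendsto (fun k => h i (q k)) atTop (𝓝 (h i x)) := fun h hh i =>
    (((hh i).contOn.continuousAt (hUo.mem_nhds hxU)).tendsto).comp hx
  have hpow : Tendsto (fun k : ℕ => (1/2:ℝ)^k * (η * Λ)) atTop (𝓝 0) := by
    simpa using (tendsto_pow_atTop_nhds_zero_of_lt_one (r := (1/2:ℝ)) (by norm_num)
      (by norm_num)).mul_const (η * Λ)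
  refine ⟨x, hxU, fun i => ?_, fun i => ?_⟩
  · have h1 : Tendsto (fun k => e (q k) i) atTop (𝓝 (e x i)) :=
      tendsto_const_nhds.sub (hfx f hf i)
    have h2 : Tendsto (fun k => e (q k) i) atTop (𝓝 0) :=
      squeeze_zero_norm (fun k => (norm_le_pi_norm _ i).trans (key k).1) hpow
    have := tendsto_nhds_unique h1 h2
    simp only [e] at this
    linarith
  · have h1 := (((hfx g hg i).sub_const (g i p)).sub_const
      (ε * ∑ j, c j * gradH (g i) p j)).abs
    refine le_of_tendsto h1 (Eventually.of_forall fun k => ((key k).2.2.1 i).trans ?_)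
    have hP0 : (0:ℝ) < (1/2)^k := by positivity
    calc η * Λ + (G + η) * (2 * (K * (η * Λ)) * (1 - (1/2:ℝ)^k))
        ≤ η * Λ + (G + 1) * (2 * (K * (η * Λ)) * 1) := by
          have : 2 * (K * (η * Λ)) * (1 - (1/2:ℝ)^k) ≤ 2 * (K * (η * Λ)) * 1 := by
            apply mul_le_mul_of_nonneg_left _ (by positivity)
            linarith
          have h8 : (G + η) * (2 * (K * (η * Λ)) * (1 - (1/2:ℝ)^k)) ≤
              (G + η) * (2 * (K * (η * Λ)) * 1) :=
            mul_le_mul_of_nonneg_left this (by positivity)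
          have h9 : (G + η) * (2 * (K * (η * Λ)) * 1) ≤ (G + 1) * (2 * (K * (η * Λ)) * 1) := by
            gcongr
          linarith
      _ = (η * (L * (1 + (G + 1) * (2 * K)))) * ε := by rw [hΛ]; ring
      _ ≤ δ * ε := by gcongr

/-- Horizontal coordinates. -/
def hc (v : Hpt n) : Fin (2*n) → ℝ := fun j =>
  if h : (j:ℕ) < n then v.1 ⟨j, h⟩ else v.2.1 ⟨(j:ℕ) - n, by omega⟩

theorem sum_split (F : Fin (2*n) → ℝ) :
    ∑ j, F j = ∑ j : Fin n, (F ⟨(j:ℕ), by omega⟩ + F ⟨n + (j:ℕ), by omega⟩) := by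
  have h : n + n = 2*n := by omega
  rw [← Equiv.sum_comp (finCongr h), Fin.sum_univ_add, Finset.sum_add_distrib]
  rfl

theorem pansuD_eq (f : Hpt n → ℝ) (p v : Hpt n) :
    pansuD f p v = ∑ j, hc v j * gradH f p j := by
  rw [sum_split]
  unfold pansuD
  refine Finset.sum_congr rfl fun j _ => ?_
  simp [hc]

theorem exists_hc (c : Fin (2*n) → ℝ) : ∃ v : Hpt n, hc v = c := by
  refine ⟨(fun j => c ⟨j, by omega⟩, fun j => c ⟨n + j, by omega⟩, 0), ?_⟩
  funext j
  unfold hc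
  split_ifs with h
  · rfl
  · simp only
    congr 1
    ext
    simp only
    omega

theorem pansuD_lin (f : Hpt n → ℝ) (p v w : Hpt n) (t : ℝ) :
    pansuD f p (v + t • w) = pansuD f p v + t * pansuD f p w := by
  unfold pansuD
  rw [Finset.mul_sum, ← Finset.sum_add_distrib]
  refine Finset.sum_congr rfl fun j _ => ?_
  simp
  ring

theorem frame_zero {k : ℕ} {S : Set (Hpt n)} {p : Hpt n} {U : Set (Hpt n)}
    {f : Fin (k+1) → Hpt n → ℝ} (hf : IsBdryFrame k S p U f) (hp : p ∈ closure S) (i : Fin k) :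
    f i.castSucc p = 0 := by
  obtain ⟨hUo, hpU, hC, -, hSU, -⟩ := hf
  have hcl : p ∈ closure (U ∩ S) := by
    have := hUo.inter_closure (t := S)
    exact this ⟨hpU, hp⟩
  haveI := mem_closure_iff_nhdsWithin_neBot.1 hcl
  have h1 : Tendsto (f i.castSucc) (𝓝[U ∩ S] p) (𝓝 (f i.castSucc p)) :=
    (((hC i.castSucc).contOn).continuousAt (hUo.mem_nhds hpU)).tendsto.mono_left nhdsWithin_le_nhds
  have h2 : Tendsto (f i.castSucc) (𝓝[U ∩ S] p) (𝓝 0) := by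
    refine tendsto_const_nhds.congr' ?_
    filter_upwards [self_mem_nhdsWithin] with q hq
    rw [hSU] at hq
    exact (hq.2.1 i).symm
  exact tendsto_nhds_unique h1 h2

theorem frame_compare {k : ℕ} {S : Set (Hpt n)} {p : Hpt n} {U : Set (Hpt n)}
    {f g : Fin (k+1) → Hpt n → ℝ} (hf : IsBdryFrame k S p U f) (hg : IsBdryFrame k S p U g)
    (hp : p ∈ closure S) (v : Hpt n) (hv : ∀ i : Fin k, pansuD (f i.castSucc) p v = 0)
    (hv' : 0 < pansuD (f (Fin.last k)) p v) :
    (∀ i : Fin k, pansuD (g i.castSucc) p v = 0) ∧ 0 ≤ pansuD (g (Fin.last k)) p v := by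
  have main : ∀ δ > 0, (∀ i : Fin k, |pansuD (g i.castSucc) p v| ≤ δ) ∧
      -δ ≤ pansuD (g (Fin.last k)) p v := by
    intro δ hδ
    obtain ⟨ε, hε, q, hqU, h1, h2⟩ := solve_core hf.1 hf.2.1 f g hf.2.2.1 hg.2.2.1
      (hf.2.2.2.1 p hf.2.1) (hc v) δ hδ
    simp only [← pansuD_eq] at h1 h2
    have hqS : q ∈ U ∩ S := by
      rw [hf.2.2.2.2.1]
      refine ⟨hqU, fun i => ?_, ?_⟩
      · rw [h1, frame_zero hf hp, hv]; simp
      · rw [h1, hf.2.2.2.2.2]; simp only [zero_add]; positivity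
    rw [hg.2.2.2.2.1] at hqS
    obtain ⟨-, g1, g2⟩ := hqS
    refine ⟨fun i => ?_, ?_⟩
    · have := h2 i.castSucc
      rw [g1, frame_zero hg hp] at this
      simp only [sub_zero, zero_sub, abs_neg, abs_mul, abs_of_pos hε] at this
      nlinarith
    · have := (abs_le.1 (h2 (Fin.last k))).2
      rw [hg.2.2.2.2.2] at this
      nlinarith
  refine ⟨fun i => ?_, ?_⟩
  · rw [← abs_nonpos_iff]
    exact le_of_forall_pos_le_add fun δ hδ => by simpa using (main δ hδ).1 i
  · exact le_of_forall_pos_le_add fun δ hδ => by linarith [(main δ hδ).2]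

theorem frame_exists {k : ℕ} {S : Set (Hpt n)} {p : Hpt n} {U : Set (Hpt n)}
    {f : Fin (k+1) → Hpt n → ℝ} (hf : IsBdryFrame k S p U f) :
    ∃ v : Hpt n, (∀ i : Fin k, pansuD (f i.castSucc) p v = 0) ∧
      pansuD (f (Fin.last k)) p v = 1 := by
  obtain ⟨A, K, hK, hA, -⟩ := exists_right_inv _ (hf.2.2.2.1 p hf.2.1)
  obtain ⟨v, hv⟩ := exists_hc (A (Pi.single (Fin.last k) 1))
  refine ⟨v, fun i => ?_, ?_⟩
  · rw [pansuD_eq, hv, hA]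
    exact Pi.single_eq_of_ne (Fin.castSucc_lt_last i).ne _
  · rw [pansuD_eq, hv, hA]; simp

theorem ker_incl {k : ℕ} {S : Set (Hpt n)} {p : Hpt n} {U : Set (Hpt n)}
    {f g : Fin (k+1) → Hpt n → ℝ} (hf : IsBdryFrame k S p U f) (hg : IsBdryFrame k S p U g)
    (hp : p ∈ closure S) (v : Hpt n) (hv : ∀ i : Fin k, pansuD (f i.castSucc) p v = 0) :
    ∃ a : ℝ, 0 ≤ a ∧ (∀ i : Fin k, pansuD (g i.castSucc) p v = 0) ∧
      pansuD (g (Fin.last k)) p v = a * pansuD (f (Fin.last k)) p v ∧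
      ∀ w, (∀ i : Fin k, pansuD (f i.castSucc) p w = 0) →
        pansuD (g (Fin.last k)) p w = a * pansuD (f (Fin.last k)) p w := by
  obtain ⟨v0, h0, h1⟩ := frame_exists hf
  obtain ⟨g0, g1⟩ := frame_compare hf hg hp v0 h0 (by rw [h1]; norm_num)
  have claim : ∀ w, (∀ i : Fin k, pansuD (f i.castSucc) p w = 0) →
      pansuD (g (Fin.last k)) p w
        = pansuD (g (Fin.last k)) p v0 * pansuD (f (Fin.last k)) p w := by
    intro w hw
    set b := pansuD (g (Fin.last k)) p v0 with hb
    have h2 : ∀ t : ℝ, 0 ≤ b + t * (pansuD (g (Fin.last k)) p w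
        - pansuD (f (Fin.last k)) p w * b) := by
      intro t
      have := (frame_compare hf hg hp
        ((v0 + t • w) + (-(t * pansuD (f (Fin.last k)) p w)) • v0)
        (fun i => by rw [pansuD_lin, pansuD_lin, h0, hw]; ring)
        (by rw [pansuD_lin, pansuD_lin, h1]; ring_nf; norm_num)).2
      rw [pansuD_lin, pansuD_lin, ← hb] at this
      linarith
    set d := pansuD (g (Fin.last k)) p w - pansuD (f (Fin.last k)) p w * b with hd
    have hd0 : d = 0 := by
      by_contra hne
      have := h2 (-(b + 1)/d)
      rw [div_mul_cancel₀ _ hne] at this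
      linarith
    linarith
  refine ⟨_, g1, fun i => ?_, claim v hv, claim⟩
  have := (frame_compare hf hg hp (v + (1 - pansuD (f (Fin.last k)) p v) • v0)
    (fun i => by rw [pansuD_lin, h0, hv]; ring) (by rw [pansuD_lin, h1]; norm_num)).1 i
  rw [pansuD_lin, g0 i] at this
  linarith

/-- **Uniqueness up to a positive scalar of the last defining differential on the tangent
cone** (Lemma 3.10): if `1 ≤ k ≤ n−1`, `S` is a `k`-codimensional `C¹_ℍ`-regular submanifold
with boundary in `O`, `p ∈ O ∩ ∂S`, and `f₁,…,f_{k+1}` and `g₁,…,g_{k+1}` are two families of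
locally defining functions at `p` on the same neighbourhood `U`, then there is `C > 0` with
`(d_ℍf_{k+1})_p = C(d_ℍg_{k+1})_p` on the tangent cone `T^ℍ_pS = ker d_ℍ(f₁,…,f_k)_p`. -/
theorem last_differential_unique {n : ℕ} (hn : 1 ≤ n) (D : HomDist n)
    (k : ℕ) (hk1 : 1 ≤ k) (hk2 : k ≤ n - 1)
    (O : Set (Hpt n)) (hO : IsOpen O) (S : Set (Hpt n)) (hSO : S ⊆ O)
    (hS : IsC1HSubWithBdry D k O S)
    (p : Hpt n) (hp : p ∈ O ∩ bdry S)
    (U : Set (Hpt n)) (f g : Fin (k+1) → Hpt n → ℝ)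
    (hf : IsBdryFrame k S p U f) (hg : IsBdryFrame k S p U g) :
    ∃ C : ℝ, 0 < C ∧ ∀ v : Hpt n, (∀ i : Fin k, pansuD (f i.castSucc) p v = 0) →
      pansuD (f (Fin.last k)) p v = C * pansuD (g (Fin.last k)) p v := by
  have hpc : p ∈ closure S := hp.2.1
  obtain ⟨v1, hv1, hv1'⟩ := frame_exists hg
  obtain ⟨a, ha, -, -, -⟩ := ker_incl hg hf hpc v1 hv1
  obtain ⟨-, -, hF, -, -⟩ := ker_incl hg hf hpc v1 hv1
  obtain ⟨b, hb0, -, hb1, hb⟩ := ker_incl hf hg hpc v1 hF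
  have hbne : b ≠ 0 := by
    rintro rfl
    rw [hv1'] at hb1
    norm_num at hb1
  refine ⟨b⁻¹, inv_pos.2 (lt_of_le_of_ne hb0 hbne.symm), fun v hv => ?_⟩
  rw [hb v hv]
  field_simp

end Heis
end
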